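/- For every T > 0, every real β > 0 that is not an integer, and all i, j ∈ ℕ with i ≥ j, the matrix element of the Riemann–Liouville fractional integration operator of order β relative to the Legendre polynomials satisfies P_{ij}^{-β} = ∫₀^T P̂(i,t) · (J^β P̂(j,·))(t) dt = (1/Γ(β+1)) · √((2j+1)/T) · F_i^β · Σ_{k=0}^j (-1)^{j-k} · ∏_{m=1}^k [ (β+m)/m · (j-m+1)/(β-i+m) · (j+m)/(β+i+m+1) ]. -/

import Mathlib

open MeasureTheory Finset

/-- Coefficients of the shifted Legendre polynomials:
`l_{ik} = (-1)^(i-k) * C(i+k, i) * C(i, i-k)`. -/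
noncomputable def legCoef (i k : ℕ) : ℝ :=
  (-1 : ℝ) ^ (i - k) * (Nat.choose (i + k) i : ℝ) * (Nat.choose i (i - k) : ℝ)

/-- Shifted Legendre polynomials on `[0, T]`, orthonormal in `L²([0,T])`:
`P̂(i,t) = √((2i+1)/T) · Σ_{k=0}^i l_{ik} (t/T)^k`. -/
noncomputable def legP (T : ℝ) (i : ℕ) (t : ℝ) : ℝ :=
  Real.sqrt ((2 * i + 1) / T) * ∑ k ∈ Finset.range (i + 1), legCoef i k * (t / T) ^ k

/-- `F_i^α = ∫₀^T t^α P̂(i,t) dt`, the expansion coefficient of the power function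
`t ↦ t^α` relative to the `i`-th Legendre polynomial. -/
noncomputable def Fcoef (T α : ℝ) (i : ℕ) : ℝ :=
  ∫ t in (0:ℝ)..T, t ^ α * legP T i t

/-- Rising factorial `x^{\overline{k}} = x(x+1)⋯(x+k-1)`. -/
noncomputable def riseFac (x : ℝ) (k : ℕ) : ℝ :=
  ∏ m ∈ Finset.range k, (x + m)

/-- Left-sided Riemann–Liouville fractional integral of order `β`:
`(J^β φ)(t) = (1/Γ(β)) ∫₀^t φ(τ)(t-τ)^{β-1} dτ`. -/
noncomputable def rlInt (β : ℝ) (φ : ℝ → ℝ) (t : ℝ) : ℝ :=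
  (1 / Real.Gamma β) * ∫ τ in (0:ℝ)..t, φ τ * (t - τ) ^ (β - 1)

/-- Euler's beta integral with a natural exponent, scaled to `[0, t]`. -/
lemma integral_pow_mul_sub_rpow (k : ℕ) {β t : ℝ} (hβ : 0 < β) (ht : 0 ≤ t) :
    ∫ τ in (0:ℝ)..t, τ ^ k * (t - τ) ^ (β - 1) =
      (k.factorial : ℝ) * Real.Gamma β / Real.Gamma (β + k + 1) * t ^ (β + k) := by
  rcases ht.eq_or_lt with rfl | ht
  · rw [intervalIntegral.integral_same, Real.zero_rpow (by positivity), mul_zero]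
  have h := Complex.betaIntegral_scaled (k + 1 : ℂ) (β : ℂ) ht
  rw [Complex.betaIntegral_eq_Gamma_mul_div _ _ (by simp; positivity) (by simpa using hβ)] at h
  apply Complex.ofReal_injective
  rw [← intervalIntegral.integral_ofReal]
  have hcongr : ∫ τ in (0:ℝ)..t, ((τ ^ k * (t - τ) ^ (β - 1) : ℝ) : ℂ) =
      ∫ τ in (0:ℝ)..t, (τ : ℂ) ^ ((k : ℂ) + 1 - 1) * ((t : ℂ) - τ) ^ ((β : ℂ) - 1) := by
    refine intervalIntegral.integral_congr fun τ hτ => ?_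
    rw [Set.uIcc_of_le ht.le] at hτ
    simp only [add_sub_cancel_right, Complex.cpow_natCast]
    rw [Complex.ofReal_mul, Complex.ofReal_cpow (sub_nonneg.2 hτ.2)]
    push_cast
    rfl
  rw [hcongr, h, Complex.Gamma_nat_eq_factorial, Complex.Gamma_ofReal]
  have e1 : (k + 1 + β : ℂ) = ((β + k + 1 : ℝ) : ℂ) := by push_cast; ring
  have e2 : (((β + k + 1 : ℝ) : ℂ) - 1) = ((β + k : ℝ) : ℂ) := by push_cast; ring
  rw [e1, e2, Complex.Gamma_ofReal, ← Complex.ofReal_cpow ht.le]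
  push_cast
  ring

lemma legCoef_succ {i m : ℕ} (h : m < i) :
    legCoef i (m + 1) * ((m : ℝ) + 1) ^ 2 = -(legCoef i m * ((i : ℝ) - m) * (i + m + 1)) := by
  have h1 : ((i + (m + 1)).choose i : ℝ) * (m + 1) = (i + m).choose i * (i + m + 1) := by
    have := Nat.add_one_mul_choose_eq (i + m) m
    rw [Nat.choose_symm_add, Nat.choose_symm_add, ← add_assoc]
    have := congrArg (Nat.cast (R := ℝ)) this
    push_cast at this
    linarith
  have h2 : (i.choose (i - (m + 1)) : ℝ) * (m + 1) = i.choose (i - m) * ((i : ℝ) - m) := by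
    rw [Nat.choose_symm h, Nat.choose_symm h.le, ← Nat.cast_sub h.le]
    exact_mod_cast Nat.choose_succ_right_eq i m
  have h3 : (-1 : ℝ) ^ (i - m) = -(-1 : ℝ) ^ (i - (m + 1)) := by
    rw [show i - m = (i - (m + 1)) + 1 by omega, pow_succ]
    ring
  unfold legCoef
  rw [h3]
  linear_combination (-1 : ℝ) ^ (i - (m + 1)) * (i.choose (i - (m + 1)) : ℝ) * (m + 1) * h1 +
    (-1 : ℝ) ^ (i - (m + 1)) * ((i + m).choose i : ℝ) * (i + m + 1) * h2

/-- Shift relation for the Mellin transform of the Legendre polynomials. -/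
lemma sum_legCoef_div_shift (i : ℕ) {x : ℝ} (hx : 0 < x) :
    (x - i) * (x + i + 1) * ∑ m ∈ range (i + 1), legCoef i m / (x + 1 + m) =
      x ^ 2 * ∑ m ∈ range (i + 1), legCoef i m / (x + m) := by
  have key : ∀ n ≤ i, ∑ m ∈ range n, ((x - i) * (x + i + 1) * (legCoef i m / (x + 1 + m)) -
      x ^ 2 * (legCoef i m / (x + m))) = legCoef i n * n ^ 2 / (x + n) := by
    intro n
    induction n with
    | zero => simp
    | succ n ih =>
      intro hn
      rw [sum_range_succ, ih (by omega)]
      push_cast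
      rw [legCoef_succ hn]
      have h1 : x + n ≠ 0 := by positivity
      have h2 : x + 1 + n ≠ 0 := by positivity
      have h3 : x + (n + 1) ≠ 0 := by positivity
      field_simp
      ring
  rw [← sub_eq_zero, mul_sum, mul_sum, ← sum_sub_distrib, sum_range_succ, key i le_rfl]
  have h1 : x + i ≠ 0 := by positivity
  have h2 : x + 1 + i ≠ 0 := by positivity
  field_simp
  ring

lemma continuous_legP (T : ℝ) (i : ℕ) : Continuous (legP T i) := by
  unfold legP
  fun_prop

lemma Fcoef_eq_sum {T α : ℝ} (hT : 0 < T) (hα : 0 < α) (i : ℕ) :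
    Fcoef T α i = Real.sqrt ((2 * i + 1) / T) * T ^ (α + 1) *
      ∑ m ∈ range (i + 1), legCoef i m / (α + 1 + m) := by
  have hcongr : Fcoef T α i = ∫ t in (0:ℝ)..T, ∑ m ∈ range (i + 1),
      Real.sqrt ((2 * i + 1) / T) * (legCoef i m / T ^ m) * t ^ (α + m) := by
    refine intervalIntegral.integral_congr fun t ht => ?_
    rw [Set.uIcc_of_le hT.le] at ht
    simp only [legP, mul_sum]
    refine sum_congr rfl fun m _ => ?_
    rw [Real.rpow_add_natCast' ht.1 (by positivity), div_pow]
    ring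
  rw [hcongr, intervalIntegral.integral_finsetSum, mul_sum]
  · refine sum_congr rfl fun m _ => ?_
    have h0 : 0 < α + m := by positivity
    have h1 : α + m + 1 ≠ 0 := by positivity
    have h2 : α + 1 + m ≠ 0 := by positivity
    rw [intervalIntegral.integral_const_mul, integral_rpow (Or.inl (by linarith)),
      Real.zero_rpow h1, show α + m + 1 = α + 1 + m by ring, Real.rpow_add_natCast hT.ne']
    field_simp
    ring
  · intro m _
    exact (intervalIntegral.intervalIntegrable_rpow (Or.inl (by positivity))).const_mul _

lemma Fcoef_add_one {T α : ℝ} (hT : 0 < T) (hα : 0 < α) (i : ℕ) :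
    (α + 1 - i) * (α + i + 2) * Fcoef T (α + 1) i = T * (α + 1) ^ 2 * Fcoef T α i := by
  rw [Fcoef_eq_sum hT hα, Fcoef_eq_sum hT (by positivity), Real.rpow_add_one hT.ne' (α + 1)]
  linear_combination Real.sqrt ((2 * i + 1) / T) * T ^ (α + 1) * T *
    sum_legCoef_div_shift i (x := α + 1) (by positivity)

lemma rlInt_legP {T β t : ℝ} (hβ : 0 < β) (ht : 0 ≤ t) (j : ℕ) :
    rlInt β (legP T j) t = ∑ k ∈ range (j + 1), Real.sqrt ((2 * j + 1) / T) *
      (legCoef j k / T ^ k * (k.factorial / Real.Gamma (β + k + 1))) * t ^ (β + k) := by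
  have hkernel : IntervalIntegrable (fun τ : ℝ => (t - τ) ^ (β - 1)) volume 0 t := by
    have h : IntervalIntegrable (fun τ : ℝ => τ ^ (β - 1)) volume 0 t :=
      intervalIntegral.intervalIntegrable_rpow' (by linarith)
    simpa using (h.comp_sub_left t).symm
  have hΓ := (Real.Gamma_pos_of_pos hβ).ne'
  have hcongr : ∀ τ : ℝ, legP T j τ * (t - τ) ^ (β - 1) = ∑ k ∈ range (j + 1),
      Real.sqrt ((2 * j + 1) / T) * (legCoef j k / T ^ k) * (τ ^ k * (t - τ) ^ (β - 1)) := by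
    intro τ
    simp only [legP, mul_sum, sum_mul]
    refine sum_congr rfl fun k _ => ?_
    rw [div_pow]
    ring
  simp only [rlInt, hcongr]
  rw [intervalIntegral.integral_finsetSum, mul_sum]
  · refine sum_congr rfl fun k _ => ?_
    rw [intervalIntegral.integral_const_mul, integral_pow_mul_sub_rpow k hβ ht]
    field_simp
  · intro k _
    exact (hkernel.continuousOn_mul (continuous_pow k).continuousOn).const_mul _

lemma integral_legP_mul_rlInt {T β : ℝ} (hT : 0 < T) (hβ : 0 < β) (i j : ℕ) :
    ∫ t in (0:ℝ)..T, legP T i t * rlInt β (legP T j) t = ∑ k ∈ range (j + 1),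
      Real.sqrt ((2 * j + 1) / T) *
        (legCoef j k / T ^ k * (k.factorial / Real.Gamma (β + k + 1))) * Fcoef T (β + k) i := by
  have hcongr : ∫ t in (0:ℝ)..T, legP T i t * rlInt β (legP T j) t =
      ∫ t in (0:ℝ)..T, ∑ k ∈ range (j + 1), Real.sqrt ((2 * j + 1) / T) *
        (legCoef j k / T ^ k * (k.factorial / Real.Gamma (β + k + 1))) *
          (t ^ (β + k) * legP T i t) := by
    refine intervalIntegral.integral_congr fun t ht => ?_
    rw [Set.uIcc_of_le hT.le] at ht
    simp only [rlInt_legP hβ ht.1, mul_sum]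
    refine sum_congr rfl fun k _ => ?_
    ring
  rw [hcongr, intervalIntegral.integral_finsetSum]
  · simp only [intervalIntegral.integral_const_mul, Fcoef]
  · intro k _
    have h0 : 0 ≤ β + k := by positivity
    exact (((Real.continuous_rpow_const h0).mul (continuous_legP T i)).intervalIntegrable
      0 T).const_mul _

/-- The summands of the matrix element in product form. -/
lemma legCoef_mul_Fcoef_eq_prod {T β : ℝ} (hT : 0 < T) (hβ : 0 < β) (hβnotint : ∀ n : ℤ, β ≠ n)
    (i j : ℕ) {k : ℕ} (hk : k ≤ j) :
    legCoef j k / T ^ k * (k.factorial / Real.Gamma (β + k + 1)) * Fcoef T (β + k) i =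
      1 / Real.Gamma (β + 1) * Fcoef T β i * ((-1 : ℝ) ^ (j - k) *
        ∏ m ∈ Finset.Icc 1 k, ((β + m) / (m : ℝ) * (((j : ℝ) - m + 1) / (β - i + m)) *
          (((j : ℝ) + m) / (β + i + m + 1)))) := by
  induction k with
  | zero => simp [legCoef]; ring
  | succ k ih =>
    have hpos : 0 < β + k := by positivity
    have hne : β + k + 1 - i ≠ 0 := fun h =>
      hβnotint ((i : ℤ) - k - 1) (by push_cast; linarith)
    have hne' : β + k + i + 2 ≠ 0 := by positivity
    have hF : Fcoef T (β + k + 1) i =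
        T * (β + k + 1) ^ 2 * Fcoef T (β + k) i / ((β + k + 1 - i) * (β + k + i + 2)) := by
      rw [eq_div_iff (mul_ne_zero hne hne'), ← Fcoef_add_one hT hpos]
      ring
    have hL : legCoef j (k + 1) =
        -(legCoef j k * ((j : ℝ) - k) * (j + k + 1)) / ((k : ℝ) + 1) ^ 2 := by
      rw [eq_div_iff (by positivity), legCoef_succ hk]
    have hs : (-1 : ℝ) ^ (j - (k + 1)) = -(-1 : ℝ) ^ (j - k) := by
      rw [show j - k = (j - (k + 1)) + 1 by omega, pow_succ]
      ring
    have hG := Real.Gamma_add_one (s := β + k + 1) (by positivity)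
    have hΓ : Real.Gamma (β + k + 1) ≠ 0 := (Real.Gamma_pos_of_pos (by positivity)).ne'
    have h1 : β + k + 1 ≠ 0 := by positivity
    have h2 : (k : ℝ) + 1 ≠ 0 := by positivity
    rw [prod_Icc_succ_top (by omega), hs]
    push_cast
    rw [← add_assoc β (k : ℝ) 1, hG, hF, hL, Nat.factorial_succ, pow_succ T]
    push_cast
    have hstep : -(legCoef j k * ((j : ℝ) - k) * (j + k + 1)) / ((k : ℝ) + 1) ^ 2 / (T ^ k * T) *
        (((k : ℝ) + 1) * k.factorial / ((β + k + 1) * Real.Gamma (β + k + 1))) *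
        (T * (β + k + 1) ^ 2 * Fcoef T (β + k) i / ((β + k + 1 - i) * (β + k + i + 2))) =
        legCoef j k / T ^ k * (k.factorial / Real.Gamma (β + k + 1)) * Fcoef T (β + k) i *
        -((β + k + 1) / ((k : ℝ) + 1) * (((j : ℝ) - k) / (β + k + 1 - i)) *
          (((j : ℝ) + k + 1) / (β + k + i + 2))) := by
      field_simp
    rw [hstep, ih (by omega), show β - i + ((k : ℝ) + 1) = β + k + 1 - i by ring,
      show β + i + ((k : ℝ) + 1) + 1 = β + k + i + 2 by ring]
    ring

/-- for non-integer `β > 0` and `i ≥ j`, the matrix element of the fractional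
integration operator of order `β` relative to the Legendre polynomials is
`P_{ij}^{-β} = (1/Γ(β+1)) √((2j+1)/T) F_i^β Σ_{k=0}^j (-1)^{j-k}
  ∏_{m=1}^k (β+m)/m (j-m+1)/(β-i+m) (j+m)/(β+i+m+1)`. -/
theorem legP_fracint_matrix (T : ℝ) (hT : 0 < T) (β : ℝ) (hβ : 0 < β)
    (hβnotint : ∀ n : ℤ, β ≠ n) (i j : ℕ) (hij : j ≤ i) :
    (∫ t in (0:ℝ)..T, legP T i t * rlInt β (legP T j) t) =
      (1 / Real.Gamma (β + 1)) * Real.sqrt ((2 * j + 1) / T) * Fcoef T β i *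
        ∑ k ∈ Finset.range (j + 1),
          (-1 : ℝ) ^ (j - k) *
            ∏ m ∈ Finset.Icc 1 k,
              ((β + m) / (m : ℝ) * (((j : ℝ) - m + 1) / (β - i + m)) *
                (((j : ℝ) + m) / (β + i + m + 1))) := by
  rw [integral_legP_mul_rlInt hT hβ, mul_sum]
  refine sum_congr rfl fun k hk => ?_
  have h := legCoef_mul_Fcoef_eq_prod hT hβ hβnotint i j (Nat.lt_succ_iff.1 (mem_range.1 hk))
  linear_combination Real.sqrt ((2 * j + 1) / T) * h
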